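/- arXiv:math/0310200 — 6 statements merged into one kernel-verified Lean document; each statement's English description precedes it below -/
import Mathlib

section
/- Let p be a prime, let U be a non-empty proper subset of F_p \ {0}, and let π be a permutation of F_p such that for all i, j ∈ F_p, i − j ∈ U implies π(i) − π(j) ∈ U. Then there exist a, b ∈ F_p with a ≠ 0 such that π(i) = a·i + b for all i ∈ F_p. -/
open Polynomial in
/-- A nonempty finite set of nonzero elements of a field has a nonvanishing power sum whose
exponent is positive and at most the cardinality of the set. -/
theorem exists_sum_pow_ne_zero {K : Type*} [Field K] [DecidableEq K] (U : Finset K)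
    (hne : U.Nonempty) (h0 : 0 ∉ U) :
    ∃ m, 0 < m ∧ m ≤ U.card ∧ ∑ u ∈ U, u ^ m ≠ 0 := by
  by_contra! H
  obtain ⟨v, hv⟩ := hne
  let g : K[X] := X * ∏ w ∈ U.erase v, (X - C w)
  have hdeg : g.natDegree < U.card + 1 := by
    have h1 : (∏ w ∈ U.erase v, (X - C w)).natDegree = (U.erase v).card :=
      natDegree_finsetProd_X_sub_C_eq_card _ _
    have h2 : g.natDegree ≤ (X : K[X]).natDegree + _ := natDegree_mul_le
    rw [h1, natDegree_X] at h2
    have := Finset.card_erase_add_one hv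
    omega
  have hsum : ∑ u ∈ U, g.eval u = g.eval v := by
    refine Finset.sum_eq_single_of_mem v hv fun u hu huv => ?_
    simp only [g, eval_mul, eval_prod]
    rw [Finset.prod_eq_zero (Finset.mem_erase.2 ⟨huv, hu⟩) (by simp), mul_zero]
  have hzero : ∑ u ∈ U, g.eval u = 0 := by
    simp_rw [eval_eq_sum_range' hdeg]
    rw [Finset.sum_comm]
    refine Finset.sum_eq_zero fun k hk => ?_
    rw [← Finset.mul_sum]
    rcases Nat.eq_zero_or_pos k with rfl | hk0
    · simp [g]
    · rw [H k hk0 (by simpa [Nat.lt_succ_iff] using hk), mul_zero]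
  have hv0 : v ≠ 0 := fun h => h0 (h ▸ hv)
  rw [hzero] at hsum
  simp only [g, eval_mul, eval_prod, eval_X, eval_sub, eval_C] at hsum
  refine mul_ne_zero hv0 (Finset.prod_ne_zero_iff.2 fun w hw => ?_) hsum.symm
  exact sub_ne_zero.2 (Finset.ne_of_mem_erase hw).symm

/-- If the power sums of `U` with positive exponent less than `j` vanish, then summing the
translates of `x ^ j` over `U` changes `U.card * x ^ j` by a constant only. -/
theorem sum_add_pow_of_sum_pow_eq_zero {R : Type*} [CommSemiring R] (U : Finset R) {j : ℕ}
    (hj : 0 < j) (hs : ∀ k, 0 < k → k < j → ∑ u ∈ U, u ^ k = 0) (x : R) :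
    ∑ u ∈ U, (x + u) ^ j = U.card * x ^ j + ∑ u ∈ U, u ^ j := by
  obtain ⟨j, rfl⟩ := Nat.exists_eq_succ_of_ne_zero hj.ne'
  simp_rw [add_comm x, add_pow]
  rw [Finset.sum_comm, Finset.sum_range_succ, Finset.sum_range_succ',
    Finset.sum_eq_zero fun k hk => ?_]
  · simp
  · simp_rw [mul_assoc]
    rw [← Finset.sum_mul, hs (k + 1) k.succ_pos (by simpa using hk), zero_mul]

open Polynomial in
/-- If `m` is the least positive exponent for which the power sum of `U` is nonzero, and averaging
the polynomial function `f` of degree less than `p` over translates by `U` changes it by a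
constant only, then `f` has degree at most `m`. -/
theorem natDegree_le_of_sum_eval_add_eq {p : ℕ} [Fact p.Prime] (U : Finset (ZMod p)) {m : ℕ}
    (hm : 0 < m) (hs : ∀ k, 0 < k → k < m → ∑ u ∈ U, u ^ k = 0) (hsm : ∑ u ∈ U, u ^ m ≠ 0)
    (f : (ZMod p)[X]) (hf : f.natDegree < p) (c : ZMod p)
    (hc : ∀ x, ∑ u ∈ U, f.eval (x + u) = U.card * f.eval x + c) :
    f.natDegree ≤ m := by
  by_contra! hlt
  obtain ⟨e, he⟩ := Nat.exists_eq_add_of_lt hlt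
  set n := e + 1
  have hfn : f.natDegree = m + n := by omega
  have heq : ∑ u ∈ U, taylor u f = C (U.card : ZMod p) * f + C c := by
    refine eq_of_natDegree_lt_card_of_eval_eq' _ _ Finset.univ (fun x _ => ?_) ?_
    · simpa [eval_finsetSum, taylor_eval, add_comm] using hc x
    · rw [Finset.card_univ, ZMod.card, max_lt_iff]
      constructor
      · refine (natDegree_sum_le_of_forall_le U _ (n := f.natDegree) fun u _ => ?_).trans_lt hf
        rw [natDegree_taylor]
      · exact (natDegree_add_C.trans_le (natDegree_C_mul_le _ _)).trans_lt hf
  have hcoeff := congrArg (fun g => g.coeff n) heq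
  have hd : ∀ u, (hasseDeriv n f).eval u
      = ∑ k ∈ Finset.range (m + 1), ((k + n).choose n : ZMod p) * f.coeff (k + n) * u ^ k := by
    intro u
    rw [eval_eq_sum_range' (n := m + 1)]
    · simp only [hasseDeriv_coeff]
    · have := natDegree_hasseDeriv_le f n
      omega
  simp only [finsetSum_coeff, taylor_coeff, hd, coeff_add, coeff_C_mul] at hcoeff
  rw [coeff_C_of_ne_zero (by omega), add_zero, Finset.sum_comm] at hcoeff
  simp_rw [← Finset.mul_sum] at hcoeff
  obtain ⟨m, rfl⟩ := Nat.exists_eq_succ_of_ne_zero hm.ne'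
  rw [Finset.sum_range_succ, Finset.sum_range_succ', Finset.sum_eq_zero fun k hk => ?_] at hcoeff
  · simp only [pow_zero, Finset.sum_const, nsmul_eq_mul, mul_one, zero_add, Nat.choose_self,
      Nat.cast_one, one_mul, mul_comm (f.coeff n), add_eq_left] at hcoeff
    refine mul_ne_zero (mul_ne_zero ?_ ?_) hsm hcoeff
    · have hp : p.Prime := Fact.out
      rw [Ne, ZMod.natCast_eq_zero_iff]
      intro hdvd
      have hfac : p ∣ (m + 1 + n).factorial := by
        rw [← Nat.add_choose_mul_factorial_mul_factorial (m + 1) n]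
        exact (hdvd.mul_right _).mul_right _
      have := hp.dvd_factorial.1 hfac
      omega
    · rw [← hfn, coeff_natDegree, leadingCoeff_ne_zero]
      rintro rfl
      simp at hlt
  · rw [hs (k + 1) k.succ_pos (by simpa using hk), mul_zero]

/-- An injective map sending differences in the finite set `U` to differences in `U` permutes the
differences in `U` at every point. -/
theorem image_map_add_sub_eq {G : Type*} [AddCommGroup G] [DecidableEq G] (U : Finset G)
    (π : Equiv.Perm G) (hπ : ∀ i j, i - j ∈ U → π i - π j ∈ U) (i : G) :
    U.image (fun u => π (i + u) - π i) = U := by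
  refine Finset.eq_of_subset_of_card_le ?_ (Finset.card_image_of_injective _ ?_).ge
  · exact Finset.image_subset_iff.2 fun u hu => hπ _ _ (by simpa using hu)
  · intro u v h
    simpa using h

theorem sub_mem_of_map_sub_mem {G : Type*} [AddCommGroup G] [DecidableEq G] (U : Finset G)
    (π : Equiv.Perm G) (hπ : ∀ i j, i - j ∈ U → π i - π j ∈ U) {i j : G}
    (h : π i - π j ∈ U) : i - j ∈ U := by
  rw [← image_map_add_sub_eq U π hπ j] at h
  obtain ⟨u, hu, hui⟩ := Finset.mem_image.1 h
  have : j + u = i := π.injective (sub_left_injective hui)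
  simpa [← this] using hu

theorem sum_comp_perm_add {G M : Type*} [AddCommGroup G] [DecidableEq G] [AddCommMonoid M]
    (U : Finset G) (π : Equiv.Perm G) (hπ : ∀ i j, i - j ∈ U → π i - π j ∈ U)
    (g : G → M) (i : G) : ∑ u ∈ U, g (π (i + u)) = ∑ u ∈ U, g (π i + u) := by
  conv_rhs => rw [← image_map_add_sub_eq U π hπ i]
  rw [Finset.sum_image fun u _ v _ h => by simpa using h]
  simp

open Polynomial in
theorem affine_of_preserves_differences_of_card_le {p : ℕ} [Fact p.Prime] (U : Finset (ZMod p))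
    (h0 : 0 ∉ U) (hne : U.Nonempty) (hcard : 2 * U.card < p) (π : Equiv.Perm (ZMod p))
    (hπ : ∀ i j, i - j ∈ U → π i - π j ∈ U) :
    ∃ a b : ZMod p, a ≠ 0 ∧ ∀ i, π i = a * i + b := by
  classical
  have hex := exists_sum_pow_ne_zero U hne h0
  have hmin : ∃ m, 0 < m ∧ ∑ u ∈ U, u ^ m ≠ 0 := hex.imp fun m h => ⟨h.1, h.2.2⟩
  set m := Nat.find hmin
  obtain ⟨hm, hsm⟩ : 0 < m ∧ ∑ u ∈ U, u ^ m ≠ 0 := Nat.find_spec hmin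
  have hs : ∀ k, 0 < k → k < m → ∑ u ∈ U, u ^ k = 0 := fun k hk hkm => by
    simpa [hk] using Nat.find_min hmin hkm
  have hmU : m ≤ U.card := by
    obtain ⟨k, hk, hkU, hsk⟩ := hex
    exact (Nat.find_min' hmin ⟨hk, hsk⟩).trans hkU
  obtain ⟨P, hPdeg, hP⟩ : ∃ P : (ZMod p)[X], P.natDegree < p ∧ ∀ i, P.eval i = π i := by
    refine ⟨Lagrange.interpolate Finset.univ id π, ?_, fun i =>
      Lagrange.eval_interpolate_at_node (v := id) π (Function.injective_id.injOn)
        (Finset.mem_univ i)⟩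
    have h := Lagrange.degree_interpolate_lt (s := Finset.univ) (v := id) (fun i => π i)
      (Function.injective_id.injOn)
    rw [Finset.card_univ, ZMod.card] at h
    rcases eq_or_ne (Lagrange.interpolate Finset.univ id π) 0 with hz | hz
    · rw [hz, natDegree_zero]
      exact (Fact.out : p.Prime).pos
    · exact (natDegree_lt_iff_degree_lt hz).2 h
  have key : ∀ j, 0 < j → j ≤ m → j * P.natDegree < p → j * P.natDegree ≤ m := by
    intro j hj hjm hjp
    rw [← natDegree_pow] at hjp ⊢
    refine natDegree_le_of_sum_eval_add_eq U hm hs hsm _ hjp (∑ u ∈ U, u ^ j) fun x => ?_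
    simp_rw [eval_pow, hP]
    rw [sum_comp_perm_add U π hπ (· ^ j),
      sum_add_pow_of_sum_pow_eq_zero U hj fun k hk hkj => hs k hk (hkj.trans_le hjm)]
  have hdeg : P.natDegree ≤ 1 := by
    by_contra! hn
    have hnm : P.natDegree ≤ m := by simpa using key 1 one_pos hm (by simpa using hPdeg)
    have hlt : m < (m / P.natDegree + 1) * P.natDegree := by
      rw [mul_comm]; exact Nat.lt_mul_div_succ m (by omega)
    have hle : (m / P.natDegree + 1) * P.natDegree ≤ m + P.natDegree := by
      rw [add_mul, one_mul]
      exact Nat.add_le_add_right (Nat.div_mul_le_self _ _) _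
    have hjm : m / P.natDegree + 1 ≤ m := Nat.div_lt_self hm hn
    exact hlt.not_ge (key _ (Nat.succ_pos _) hjm (hle.trans_lt (by omega)))
  obtain ⟨a, b, hab⟩ := exists_eq_X_add_C_of_natDegree_le_one hdeg
  have hπab : ∀ i, π i = a * i + b := fun i => by rw [← hP i, hab]; simp
  refine ⟨a, b, ?_, hπab⟩
  rintro rfl
  exact zero_ne_one (π.injective (by rw [hπab 0, hπab 1]; ring) : (0 : ZMod p) = 1)

/-- Schur-type proposition: a permutation of `F_p` preserving differences in a
non-empty proper subset `U` of `F_p \ {0}` is affine. -/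
theorem affine_of_preserves_differences (p : ℕ) (hp : p.Prime)
    (U : Set (ZMod p)) (hU0 : U ⊆ {x | x ≠ 0}) (hUne : U.Nonempty)
    (hUproper : U ≠ {x | x ≠ 0})
    (π : Equiv.Perm (ZMod p))
    (hπ : ∀ i j : ZMod p, i - j ∈ U → π i - π j ∈ U) :
    ∃ a b : ZMod p, a ≠ 0 ∧ ∀ i : ZMod p, π i = a * i + b := by
  classical
  have : Fact p.Prime := ⟨hp⟩
  obtain ⟨U, rfl⟩ : ∃ V : Finset (ZMod p), (V : Set (ZMod p)) = U :=
    ⟨U.toFinset, Set.coe_toFinset U⟩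
  simp only [Finset.mem_coe] at hπ
  have h0 : 0 ∉ U := fun h => hU0 (Finset.mem_coe.2 h) rfl
  by_cases hcard : 2 * U.card < p
  · exact affine_of_preserves_differences_of_card_le U h0 (by simpa using hUne) hcard π hπ
  · have hins : (insert 0 U).card = U.card + 1 := Finset.card_insert_of_notMem h0
    have hadd := Finset.card_compl_add_card (insert 0 U)
    rw [ZMod.card, hins] at hadd
    refine affine_of_preserves_differences_of_card_le (insert 0 U)ᶜ (by simp) ?_ (by omega) π
      fun i j hij => ?_
    · rw [Finset.nonempty_iff_ne_empty]
      intro hempty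
      refine hUproper (hU0.antisymm fun x hx => ?_)
      have : x ∈ insert 0 U := by
        rw [← Finset.notMem_compl, hempty]
        exact Finset.notMem_empty x
      exact Finset.mem_coe.2 ((Finset.mem_insert.1 this).resolve_left hx)
    · simp only [Finset.mem_compl, Finset.mem_insert, not_or, sub_eq_zero] at hij ⊢
      exact ⟨fun h => hij.1 (π.injective h), fun h => hij.2 (sub_mem_of_map_sub_mem U π hπ h)⟩
end

section
/- Let p be a prime and let G be a transitive permutation group on a set of p elements that is not doubly transitive. Then, after identifying the underlying set with F_p suitably, every element of G is of the form i ↦ a·i + b for some a ∈ F_p \ {0} and b ∈ F_p; in particular, G is isomorphic to a subgroup of the affine group AGL(1, p) and hence solvable. -/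
open Polynomial in
/-- If the power sums of `U` of exponents strictly between `0` and `m` vanish and the one of
exponent `m` does not, then summing translates over `U` and removing the main term lowers the
degree of a polynomial by exactly `m`. -/
theorem Polynomial.natDegree_sum_taylor_sub_card_mul {p : ℕ} [Fact p.Prime] {U : Finset (ZMod p)}
    {m : ℕ} (hlow : ∀ j, 0 < j → j < m → ∑ u ∈ U, u ^ j = 0) (htop : ∑ u ∈ U, u ^ m ≠ 0)
    (hm : 0 < m) {g : (ZMod p)[X]} (hg : g.natDegree < p) :
    (∑ u ∈ U, taylor u g - C (U.card : ZMod p) * g).natDegree = g.natDegree - m := by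
  have hcoeff (n : ℕ) : (∑ u ∈ U, taylor u g).coeff n =
      ∑ i ∈ Finset.range (g.natDegree + 1), (i.choose n : ZMod p) * g.coeff i *
        ∑ u ∈ U, u ^ (i - n) := by
    simp only [finsetSum_coeff, taylor_coeff, hasseDeriv_apply, Finset.mul_sum]
    rw [Finset.sum_comm]
    refine Finset.sum_congr rfl fun u _ => ?_
    rw [sum_over_range _ (by simp), eval_finsetSum]
    simp
  have hzero (n i : ℕ) (hi : i - n < m) (hin : i ≠ n) :
      (i.choose n : ZMod p) * g.coeff i * ∑ u ∈ U, u ^ (i - n) = 0 := by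
    rcases lt_or_ge i n with h | h
    · simp [Nat.choose_eq_zero_of_lt h]
    · rw [hlow _ (by omega) hi, mul_zero]
  have hle : (∑ u ∈ U, taylor u g - C (U.card : ZMod p) * g).natDegree ≤ g.natDegree - m := by
    refine natDegree_le_iff_coeff_eq_zero.2 fun n hn => ?_
    rw [coeff_sub, coeff_C_mul, hcoeff, sub_eq_zero, Finset.sum_eq_single n]
    · simp [mul_comm]
    · intro i hi hin
      rw [Finset.mem_range] at hi
      exact hzero n i (by omega) hin
    · intro h
      rw [coeff_eq_zero_of_natDegree_lt (by simpa using h)]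
      simp
  rcases lt_or_ge g.natDegree m with h | h
  · omega
  rcases eq_or_ne g 0 with rfl | hg0
  · simp
  refine natDegree_eq_of_le_of_coeff_ne_zero hle ?_
  have hd : g.natDegree - (g.natDegree - m) = m := by omega
  have hchoose : (g.natDegree.choose (g.natDegree - m) : ZMod p) ≠ 0 := by
    rw [Ne, ZMod.natCast_eq_zero_iff]
    intro hdvd
    have := (Nat.Prime.dvd_factorial Fact.out).1 (hdvd.trans
      (Nat.choose_mul_factorial_mul_factorial (Nat.sub_le g.natDegree m) ▸
        (dvd_mul_right _ _).mul_right _))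
    omega
  have hrest : ∑ i ∈ Finset.range g.natDegree, (i.choose (g.natDegree - m) : ZMod p) * g.coeff i *
      ∑ u ∈ U, u ^ (i - (g.natDegree - m)) = (U.card : ZMod p) * g.coeff (g.natDegree - m) := by
    rw [Finset.sum_eq_single (g.natDegree - m)]
    · simp [mul_comm]
    · intro i hi hin
      rw [Finset.mem_range] at hi
      exact hzero _ i (by omega) hin
    · intro h
      exact absurd (Finset.mem_range.2 (by omega)) h
  rw [coeff_sub, coeff_C_mul, hcoeff, Finset.sum_range_succ, hrest, add_sub_cancel_left, hd]
  exact mul_ne_zero (mul_ne_zero hchoose (leadingCoeff_ne_zero.2 hg0)) htop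

/-- A set of nonzero residues whose power sums of exponents `1, …, p - 2` all vanish is empty or
contains all nonzero residues. -/
theorem ZMod.mem_of_forall_sum_pow_eq_zero {p : ℕ} [Fact p.Prime] {U : Finset (ZMod p)}
    (h0 : 0 ∉ U) (hU : ∀ j, 0 < j → j < p - 1 → ∑ u ∈ U, u ^ j = 0) {x y : ZMod p}
    (hx : x ∈ U) (hy : y ≠ 0) : y ∈ U := by
  have hp : 0 < p - 1 := Nat.sub_pos_of_lt (Fact.out : p.Prime).one_lt
  have hne {u : ZMod p} (hu : u ∈ U) : u ≠ 0 := fun h => h0 (h ▸ hu)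
  have hgeom {t : ZMod p} (ht : t ≠ 0) :
      ∑ j ∈ Finset.range (p - 1), t ^ j = if t = 1 then -1 else 0 := by
    split_ifs with h
    · simp [h, Nat.cast_sub (Fact.out : p.Prime).one_lt.le]
    · have := geom_sum_mul t (p - 1)
      rw [ZMod.pow_card_sub_one_eq_one ht, sub_self] at this
      exact (mul_eq_zero.1 this).resolve_right (sub_ne_zero.2 h)
  have hcard {z : ZMod p} (hz : z ≠ 0) : (U.card : ZMod p) = if z ∈ U then -1 else 0 := by
    have h1 : ∑ u ∈ U, ∑ j ∈ Finset.range (p - 1), (u / z) ^ j = if z ∈ U then -1 else 0 := by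
      rw [← Finset.sum_ite_eq' U z fun _ => (-1 : ZMod p)]
      refine Finset.sum_congr rfl fun u hu => ?_
      rw [hgeom (div_ne_zero (hne hu) hz)]
      simp [div_eq_one_iff_eq hz]
    rw [← h1, Finset.sum_comm, Finset.sum_eq_single 0]
    · simp
    · intro j hj hj0
      simp only [div_pow, ← Finset.sum_div]
      rw [hU j (by omega) (Finset.mem_range.1 hj), zero_div]
    · simp [hp]
  by_contra hyU
  have := (hcard (hne hx)).symm.trans (hcard hy)
  simp [hx, hyU] at this

theorem Finset.exists_forall_sum_add_pow_eq {R : Type*} [CommRing R] {U : Finset R} {m k : ℕ}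
    (hlow : ∀ j, 0 < j → j < m → ∑ u ∈ U, u ^ j = 0) (hk : k ≤ m) :
    ∃ c, ∀ a : R, ∑ u ∈ U, (a + u) ^ k = U.card * a ^ k + c := by
  rcases k.eq_zero_or_pos with rfl | hk0
  · exact ⟨0, by simp⟩
  refine ⟨∑ u ∈ U, u ^ k, fun a => ?_⟩
  simp only [add_pow]
  rw [Finset.sum_comm]
  simp only [← Finset.sum_mul, ← Finset.mul_sum]
  rw [Finset.sum_range_succ, Finset.sum_eq_single_of_mem 0 (by simpa using hk0)]
  · simp [add_comm, mul_comm]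
  · intro j hj hj0
    rw [Finset.mem_range] at hj
    rw [hlow (k - j) (by omega) (by omega)]
    simp

theorem Finset.sum_add_pow_succ_eq {R : Type*} [CommRing R] {U : Finset R} {m : ℕ} (hm : 0 < m)
    (hlow : ∀ j, 0 < j → j < m → ∑ u ∈ U, u ^ j = 0) (a : R) :
    ∑ u ∈ U, (a + u) ^ (m + 1) =
      U.card * a ^ (m + 1) + ((m + 1) * (∑ u ∈ U, u ^ m) * a + ∑ u ∈ U, u ^ (m + 1)) := by
  simp only [add_pow]
  rw [Finset.sum_comm]
  simp only [← Finset.sum_mul, ← Finset.mul_sum]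
  rw [Finset.sum_range_succ, Finset.sum_range_succ',
    Finset.sum_eq_single_of_mem 0 (by simpa using hm)]
  · simp
    ring
  · intro j hj hj0
    rw [Finset.mem_range] at hj
    rw [hlow (m + 1 - (j + 1)) (by omega) (by omega)]
    simp

open Polynomial in
theorem ZMod.exists_polynomial_eval_eq {p : ℕ} [Fact p.Prime] (φ : ZMod p → ZMod p) :
    ∃ f : (ZMod p)[X], f.natDegree < p ∧ ∀ x, f.eval x = φ x := by
  refine ⟨Lagrange.interpolate Finset.univ id φ, ?_, fun x => ?_⟩
  · by_cases h : Lagrange.interpolate Finset.univ id φ = 0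
    · simpa [h] using (Fact.out : p.Prime).pos
    rw [natDegree_lt_iff_degree_lt h]
    simpa [ZMod.card] using Lagrange.degree_interpolate_lt (s := Finset.univ) φ
      (Function.injective_id.injOn)
  · exact Lagrange.eval_interpolate_at_node (s := Finset.univ) φ Function.injective_id.injOn
      (Finset.mem_univ x)

open Polynomial in
theorem ZMod.polynomial_eq_of_eval_eq {p : ℕ} [Fact p.Prime] {f g : (ZMod p)[X]}
    (hf : f.natDegree < p) (hg : g.natDegree < p) (h : ∀ x, f.eval x = g.eval x) : f = g := by
  refine eq_of_natDegree_lt_card_of_eval_eq f g Function.injective_id h ?_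
  rw [ZMod.card]
  exact max_lt hf hg

open Polynomial in
/-- A permutation of `ZMod p` preserving a nontrivial Cayley digraph is affine. -/
theorem ZMod.exists_affine_of_sub_mem {p : ℕ} [Fact p.Prime] {U : Finset (ZMod p)} (h0 : 0 ∉ U)
    {x y : ZMod p} (hx : x ∈ U) (hy0 : y ≠ 0) (hy : y ∉ U) (π : Equiv.Perm (ZMod p))
    (hπ : ∀ i j, j - i ∈ U → π j - π i ∈ U) : ∃ a b, ∀ i, π i = a * i + b := by
  obtain ⟨m, ⟨hm, hmp, htop⟩, hmin⟩ : ∃ m, (0 < m ∧ m < p - 1 ∧ ∑ u ∈ U, u ^ m ≠ 0) ∧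
      ∀ j < m, ¬ (0 < j ∧ j < p - 1 ∧ ∑ u ∈ U, u ^ j ≠ 0) := by
    have hex : ∃ m, 0 < m ∧ m < p - 1 ∧ ∑ u ∈ U, u ^ m ≠ 0 := by
      by_contra! h
      exact hy (mem_of_forall_sum_pow_eq_zero h0 h hx hy0)
    classical exact ⟨Nat.find hex, Nat.find_spec hex, fun _ => Nat.find_min hex⟩
  have hlow (j : ℕ) (hj0 : 0 < j) (hj : j < m) : ∑ u ∈ U, u ^ j = 0 := by
    by_contra h
    exact hmin j hj ⟨hj0, by omega, h⟩
  have himage (i : ZMod p) : U.image (fun u => π (i + u) - π i) = U := by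
    refine Finset.eq_of_subset_of_card_le ?_ (Finset.card_image_of_injective _ fun u v h => ?_).ge
    · exact Finset.image_subset_iff.2 fun u hu => hπ _ _ (by simpa using hu)
    · simpa using h
  have hsum (k : ℕ) (i : ZMod p) : ∑ u ∈ U, π (i + u) ^ k = ∑ u ∈ U, (π i + u) ^ k := by
    conv_rhs => rw [← himage i]
    rw [Finset.sum_image fun u _ v _ h => by simpa using h]
    simp
  choose f hfp hf using fun k : ℕ => exists_polynomial_eval_eq fun i => π i ^ k
  have hT (k : ℕ) (h : (ZMod p)[X]) (hh : h.natDegree < p)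
      (heq : ∀ i, ∑ u ∈ U, (π i + u) ^ k = U.card * π i ^ k + h.eval i) :
      (f k).natDegree - m = h.natDegree := by
    have hdeg := natDegree_sum_taylor_sub_card_mul hlow htop hm (hfp k)
    rw [← hdeg]
    refine congrArg natDegree (polynomial_eq_of_eval_eq ?_ hh fun i => ?_)
    · have := hfp k
      omega
    · simp [eval_finsetSum, taylor_eval, hf, hsum, heq]
  have hpow_le (k : ℕ) (hk : k ≤ m) : (f k).natDegree ≤ m := by
    obtain ⟨c, hc⟩ := Finset.exists_forall_sum_add_pow_eq hlow hk
    have := hT k (C c) (by simp; omega) fun i => by simp [hc]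
    rw [natDegree_C] at this
    omega
  have hr : (f 1).natDegree + m < p := by
    have hm1 : (m : ZMod p) + 1 ≠ 0 := by
      rw [← Nat.cast_succ, Ne, ZMod.natCast_eq_zero_iff]
      exact Nat.not_dvd_of_pos_of_lt (by omega) (by omega)
    have hdeg : (C ((m + 1) * ∑ u ∈ U, u ^ m) * f 1 + C (∑ u ∈ U, u ^ (m + 1))).natDegree =
        (f 1).natDegree := by
      rw [natDegree_add_C, natDegree_C_mul (mul_ne_zero hm1 htop)]
    have := hT (m + 1) _ (hdeg.trans_lt (hfp 1)) fun i => by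
      rw [Finset.sum_add_pow_succ_eq hm hlow, eval_add, eval_C_mul, eval_C, hf, pow_one]
    have := hfp (m + 1)
    omega
  have hmul (k : ℕ) (hk : k ≤ m) : k * (f 1).natDegree ≤ m := by
    induction k with
    | zero => simp
    | succ k ih =>
      have := ih (by omega)
      have hlt : ((f 1) ^ (k + 1)).natDegree < p := by
        rw [natDegree_pow, add_mul]
        omega
      rw [← natDegree_pow, polynomial_eq_of_eval_eq hlt (hfp (k + 1)) fun i => by simp [hf]]
      exact hpow_le _ hk
  have hr1 : (f 1).natDegree ≤ 1 := by nlinarith [hmul m le_rfl]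
  obtain ⟨a, b, hab⟩ := exists_eq_X_add_C_of_natDegree_le_one hr1
  exact ⟨a, b, fun i => by simpa [hf] using congrArg (eval i) hab⟩

theorem Equiv.Perm.exists_mem_orderOf_eq_card {X : Type*} [Fintype X]
    (hp : (Fintype.card X).Prime) {G : Subgroup (Equiv.Perm X)}
    (htrans : ∀ x y : X, ∃ g ∈ G, g x = y) : ∃ σ ∈ G, orderOf σ = Fintype.card X := by
  have : Fact (Fintype.card X).Prime := ⟨hp⟩
  obtain ⟨x⟩ := Fintype.card_pos_iff.1 hp.pos
  have : MulAction.IsPretransitive G X := ⟨fun x y => by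
    obtain ⟨g, hg, h⟩ := htrans x y
    exact ⟨⟨g, hg⟩, h⟩⟩
  have hdvd : Fintype.card X ∣ Nat.card G := by
    rw [← Nat.card_eq_fintype_card, ← MulAction.index_stabilizer_of_transitive G x]
    exact Subgroup.index_dvd_card _
  obtain ⟨σ, hσ⟩ := exists_prime_orderOf_dvd_card' _ hdvd
  exact ⟨σ, σ.2, by rw [Subgroup.orderOf_coe, hσ]⟩

/-- A permutation of prime order `p` on `p` points is conjugate to translation by `1`. -/
theorem Equiv.Perm.exists_equiv_zmod_of_orderOf_eq_card {X : Type*} [Fintype X]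
    (hp : (Fintype.card X).Prime) {σ : Equiv.Perm X} (hσ : orderOf σ = Fintype.card X) :
    ∃ e : X ≃ ZMod (Fintype.card X), ∀ n : ℕ, ∀ i, (σ ^ n) (e.symm i) = e.symm (i + n) := by
  classical
  have : Fact (Fintype.card X).Prime := ⟨hp⟩
  have hcycle := isCycle_of_prime_order'' hp hσ
  have hsupp : σ.support = Finset.univ :=
    Finset.eq_univ_of_card _ (hcycle.orderOf.symm.trans hσ)
  have hmove (x : X) : σ x ≠ x := mem_support.1 (hsupp ▸ Finset.mem_univ x)
  obtain ⟨x⟩ := Fintype.card_pos_iff.1 hp.pos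
  have hval (n : ℕ) : σ ^ (n : ZMod (Fintype.card X)).val = σ ^ n := by
    rw [ZMod.val_natCast, ← hσ, pow_mod_orderOf]
  have hsurj : Function.Surjective fun i : ZMod (Fintype.card X) => (σ ^ i.val) x := fun y => by
    obtain ⟨n, hn⟩ := hcycle.exists_pow_eq (hmove x) (hmove y)
    exact ⟨n, by simp only [hval, hn]⟩
  have hbij := (Fintype.bijective_iff_surjective_and_card _).2 ⟨hsurj, ZMod.card _⟩
  refine ⟨(Equiv.ofBijective _ hbij).symm, fun n i => ?_⟩
  have hadd : σ ^ (i + n).val = σ ^ n * σ ^ i.val := by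
    rw [← pow_add, ← hval (n + i.val)]
    congr 2
    simp [add_comm]
  simp [hadd]

/-- A group of permutations that are affine in some coordinate is solvable. -/
theorem Equiv.Perm.isSolvable_of_affine {F X : Type*} [Field F] (e : X ≃ F)
    {G : Subgroup (Equiv.Perm X)}
    (h : ∀ g ∈ G, ∃ a b : F, ∀ x, e (g x) = a * e x + b) : Group.IsSolvable G := by
  choose a b hab using fun g : G => h g g.2
  have hslope {g : G} {c d : F} (hcd : ∀ x, e (g.1 x) = c * e x + d) : a g = c := by
    have h0 := (hab g (e.symm 0)).symm.trans (hcd _)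
    have h1 := (hab g (e.symm 1)).symm.trans (hcd _)
    simp only [Equiv.apply_symm_apply] at h0 h1
    linear_combination h1 - h0
  let slope : G →* F :=
    { toFun := a
      map_one' := hslope (d := 0) (by simp)
      map_mul' := fun g k => hslope (d := a g * b k + b g) fun x => by
        simp only [Subgroup.coe_mul, Equiv.Perm.mul_apply, hab]
        ring }
  have hker : Group.IsSolvable slope.toHomUnits.ker := Group.isSolvable_of_comm fun g k => by
    have htrans (g : slope.toHomUnits.ker) (x : X) : e (g.1.1 x) = e x + b g.1 := by
      have hg : a g.1 = 1 := congrArg Units.val g.2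
      rw [hab, hg, one_mul]
    refine Subtype.ext (Subtype.ext (Equiv.ext fun x => e.injective ?_))
    simp only [Subgroup.coe_mul, Equiv.Perm.mul_apply, htrans]
    ring
  exact Group.isSolvable_of_ker_le_range slope.toHomUnits.ker.subtype slope.toHomUnits (by simp)


/-- A transitive but not doubly transitive permutation group of prime degree
consists, after a suitable identification of the underlying set with `F_p`,
of affine maps `i ↦ a * i + b`; in particular it is solvable. -/
theorem affine_of_not_doubly_transitive (p : ℕ) (hp : p.Prime)
    (X : Type*) [Fintype X] (hX : Fintype.card X = p)
    (G : Subgroup (Equiv.Perm X))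
    (htrans : ∀ x y : X, ∃ g ∈ G, g x = y)
    (hnot2 : ¬ ∀ x₁ x₂ y₁ y₂ : X, x₁ ≠ x₂ → y₁ ≠ y₂ →
      ∃ g ∈ G, g x₁ = y₁ ∧ g x₂ = y₂) :
    (∃ e : X ≃ ZMod p, ∀ g ∈ G, ∃ a b : ZMod p, a ≠ 0 ∧
      ∀ x : X, e (g x) = a * e x + b) ∧ IsSolvable G := by
  subst hX
  have : Fact (Fintype.card X).Prime := ⟨hp⟩
  obtain ⟨σ, hσG, hσ⟩ := Equiv.Perm.exists_mem_orderOf_eq_card hp htrans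
  obtain ⟨e, he⟩ := Equiv.Perm.exists_equiv_zmod_of_orderOf_eq_card hp hσ
  push Not at hnot2
  obtain ⟨x₁, x₂, y₁, y₂, hx, hy, hxy⟩ := hnot2
  have hshift (i j : ZMod (Fintype.card X)) :
      ∃ τ ∈ G, ∀ k, τ (e.symm (i + k)) = e.symm (j + k) := by
    refine ⟨σ ^ (j - i).val, pow_mem hσG _, fun k => ?_⟩
    rw [he, ZMod.natCast_zmod_val]
    congr 1
    ring
  classical
  let U : Finset (ZMod (Fintype.card X)) :=
    {d | ∃ g ∈ G, ∃ i, g x₁ = e.symm i ∧ g x₂ = e.symm (i + d)}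
  have hU (d) : d ∈ U ↔ ∃ g ∈ G, ∃ i, g x₁ = e.symm i ∧ g x₂ = e.symm (i + d) := by
    simp [U]
  have h0 : 0 ∉ U := fun h => by
    obtain ⟨g, -, i, h₁, h₂⟩ := (hU 0).1 h
    exact hx (g.injective (by rw [h₁, h₂, add_zero]))
  have hxU : e x₂ - e x₁ ∈ U := (hU _).2 ⟨1, one_mem G, e x₁, by simp⟩
  have hyU : e y₂ - e y₁ ∉ U := fun h => by
    obtain ⟨g, hg, i, h₁, h₂⟩ := (hU _).1 h
    obtain ⟨τ, hτ, hτe⟩ := hshift i (e y₁)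
    refine hxy (τ * g) (mul_mem hτ hg) ?_ ?_
    · simpa [h₁] using hτe 0
    · simp [h₂, hτe]
  have haff (g) (hg : g ∈ G) : ∃ a b, ∀ x, e (g x) = a * e x + b := by
    obtain ⟨a, b, hab⟩ := ZMod.exists_affine_of_sub_mem h0 hxU
      (sub_ne_zero.2 fun h => hy (e.injective h.symm)) hyU (e.permCongr g) fun i j hij => by
        obtain ⟨k, hk, l, h₁, h₂⟩ := (hU _).1 hij
        obtain ⟨τ, hτ, hτe⟩ := hshift l i
        have h₁' : τ (e.symm l) = e.symm i := by simpa using hτe 0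
        exact (hU _).2 ⟨g * (τ * k), mul_mem hg (mul_mem hτ hk), e (g (e.symm i)),
          by simp [h₁, h₁'], by simp [h₂, hτe]⟩
    exact ⟨a, b, fun x => by simpa using hab (e x)⟩
  refine ⟨⟨e, fun g hg => ?_⟩, Equiv.Perm.isSolvable_of_affine e haff⟩
  obtain ⟨a, b, hab⟩ := haff g hg
  refine ⟨a, b, ?_, hab⟩
  rintro rfl
  exact hx (g.injective (e.injective (by simp [hab])))
end

section
/- Let p be a prime and let G be a subgroup of the symmetric group on F_p that is transitive and contains the translation τ : i ↦ i + 1. If G is not doubly transitive on F_p, then there exists a non-empty proper subset U of F_p \ {0} such that for every π ∈ G and all i, j ∈ F_p, i − j ∈ U implies π(i) − π(j) ∈ U. -/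
theorem addRight_mem_of_addRight_one_mem {n : ℕ} [NeZero n] {G : Subgroup (Equiv.Perm (ZMod n))}
    (hτ : Equiv.addRight (1 : ZMod n) ∈ G) (c : ZMod n) : Equiv.addRight c ∈ G := by
  have natCast_mem (k : ℕ) : Equiv.addRight (k : ZMod n) ∈ G := by
    induction k with
    | zero =>
      convert G.one_mem
      ext i
      simp
    | succ k ih =>
      convert G.mul_mem hτ ih using 1
      ext i
      simp [add_assoc]
  simpa using natCast_mem c.val


/-- If a transitive subgroup of `Sym(F_p)` containing the translation
`i ↦ i + 1` is not doubly transitive, then there is a non-empty proper subset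
`U` of `F_p \ {0}` whose difference pattern is preserved by every element
of `G`. -/
theorem exists_invariant_difference_set (p : ℕ) (hp : p.Prime)
    (G : Subgroup (Equiv.Perm (ZMod p)))
    (htrans : ∀ x y : ZMod p, ∃ g ∈ G, g x = y)
    (hτ : Equiv.addRight (1 : ZMod p) ∈ G)
    (hnot2 : ¬ ∀ x₁ x₂ y₁ y₂ : ZMod p, x₁ ≠ x₂ → y₁ ≠ y₂ →
      ∃ g ∈ G, g x₁ = y₁ ∧ g x₂ = y₂) :
    ∃ U : Set (ZMod p), U.Nonempty ∧ U ⊆ {x | x ≠ 0} ∧ U ≠ {x | x ≠ 0} ∧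
      ∀ π ∈ G, ∀ i j : ZMod p, i - j ∈ U → (π : Equiv.Perm (ZMod p)) i - π j ∈ U := by
  have : NeZero p := ⟨hp.ne_zero⟩
  have translate {g : Equiv.Perm (ZMod p)} (hg : g ∈ G) {x₁ x₂ i j : ZMod p}
      (h : g x₁ - g x₂ = i - j) : ∃ g' ∈ G, g' x₁ = i ∧ g' x₂ = j := by
    refine ⟨_, G.mul_mem (addRight_mem_of_addRight_one_mem hτ (j - g x₂)) hg, ?_, ?_⟩
    · rw [Equiv.Perm.mul_apply, Equiv.coe_addRight]
      linear_combination h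
    · simp
  push Not at hnot2
  obtain ⟨x₁, x₂, y₁, y₂, hx, hy, hno⟩ := hnot2
  refine ⟨{d | ∃ g ∈ G, g x₁ - g x₂ = d}, ⟨_, 1, G.one_mem, rfl⟩, ?_, ?_, ?_⟩
  · rintro _ ⟨g, -, rfl⟩
    exact sub_ne_zero.mpr (g.injective.ne hx)
  · intro hU
    obtain ⟨g, hg, hgy⟩ := hU.ge (sub_ne_zero.mpr hy)
    obtain ⟨g', hg', h₁, h₂⟩ := translate hg hgy
    exact hno g' hg' h₁ h₂
  · rintro π hπ i j ⟨g, hg, hgij⟩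
    obtain ⟨g', hg', rfl, rfl⟩ := translate hg hgij
    exact ⟨π * g', G.mul_mem hπ hg', rfl⟩
end

section
/- Let p be a prime, U a subset of F_p \ {0}, and π a permutation of F_p such that for all i, j ∈ F_p, i − j ∈ U implies π(i) − π(j) ∈ U. Then for every i ∈ F_p and every natural number w, one has ∑_{u ∈ U} π(i + u)^w = ∑_{u ∈ U} (π(i) + u)^w in F_p. -/
/-- Power sum identity for a permutation of `F_p` preserving `U`-differences. -/
theorem power_sum_identity (p : ℕ) (hp : p.Prime)
    (U : Finset (ZMod p)) (hU0 : ∀ u ∈ U, u ≠ 0)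
    (π : Equiv.Perm (ZMod p))
    (hπ : ∀ i j : ZMod p, i - j ∈ U → π i - π j ∈ U) :
    ∀ (i : ZMod p) (w : ℕ),
      ∑ u ∈ U, (π (i + u)) ^ w = ∑ u ∈ U, (π i + u) ^ w := by
  intro i w
  have hmaps : ∀ u ∈ U, π (i + u) - π i ∈ U := fun u hu => hπ _ _ (by simpa using hu)
  have hinj : Set.InjOn (fun u => π (i + u) - π i) U := fun u _ v _ h => by simpa using h
  exact Finset.sum_nbij (fun u => π (i + u) - π i) hmaps hinj
    (Finset.surjOn_of_injOn_of_card_le _ hmaps hinj le_rfl) (fun u _ => by simp)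
end

section
/- Let p be a prime, U a subset of F_p \ {0}, and π a permutation of F_p such that for all i, j ∈ F_p, i − j ∈ U implies π(i) − π(j) ∈ U. Let f ∈ F_p[X] be the polynomial of degree n ≤ p − 1 with f(i) = π(i) for all i ∈ F_p, and let w be a positive natural number with w·n ≤ p − 1. Then ∑_{u ∈ U} f(X + u)^w = ∑_{u ∈ U} (f(X) + u)^w as an identity of polynomials in F_p[X]. -/
open Polynomial

/-- A permutation preserving `U`-differences permutes the translates: summing `g` over
`π (i + u)` is the same as summing it over `π i + u`. -/
theorem sum_perm_add_eq_sum_add_of_preserves_differences {G M : Type*} [AddCommGroup G]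
    [AddCommMonoid M] (U : Finset G) (π : Equiv.Perm G)
    (hπ : ∀ i j : G, i - j ∈ U → π i - π j ∈ U) (g : G → M) (i : G) :
    ∑ u ∈ U, g (π (i + u)) = ∑ u ∈ U, g (π i + u) := by
  have maps : ∀ u ∈ U, π (i + u) - π i ∈ U := fun u hu => hπ _ _ (by simpa using hu)
  have inj : Set.InjOn (fun u => π (i + u) - π i) U := fun a _ b _ h => by simpa using h
  refine Finset.sum_bij (fun u _ => π (i + u) - π i) maps
    (fun a ha b hb h => inj ha hb h) (fun b hb => ?_) (fun u _ => by simp)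
  obtain ⟨a, ha, rfl⟩ := Finset.surjOn_of_injOn_of_card_le _ maps inj le_rfl hb
  exact ⟨a, ha, rfl⟩

/-- Polynomial identity obtained from the power sum identity, valid as long as
`w * n ≤ p - 1`, where `n` is the degree of the polynomial `f` interpolating
the permutation `π`. -/
theorem polynomial_power_sum_identity (p : ℕ) (hp : p.Prime)
    (U : Finset (ZMod p)) (hU0 : ∀ u ∈ U, u ≠ 0)
    (π : Equiv.Perm (ZMod p))
    (hπ : ∀ i j : ZMod p, i - j ∈ U → π i - π j ∈ U)
    (f : Polynomial (ZMod p)) (n : ℕ) (hn : f.natDegree = n)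
    (hnp : n ≤ p - 1)
    (hf : ∀ i : ZMod p, f.eval i = π i)
    (w : ℕ) (hw : 0 < w) (hwn : w * n ≤ p - 1) :
    ∑ u ∈ U, (f.comp (X + C u)) ^ w = ∑ u ∈ U, (f + C u) ^ w := by
  have : Fact p.Prime := ⟨hp⟩
  have hlt : w * n < p := by have := hp.pos; omega
  have deg : ∀ q : (ZMod p)[X], q.natDegree ≤ n → (q ^ w).natDegree ≤ w * n := fun q hq =>
    natDegree_pow_le.trans (Nat.mul_le_mul_left w hq)
  refine eq_of_natDegree_lt_card_of_eval_eq _ _ (f := id) Function.injective_id (fun i => ?_) ?_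
  · simpa [eval_finsetSum, hf] using
      sum_perm_add_eq_sum_add_of_preserves_differences U π hπ (fun x => x ^ w) i
  · rw [ZMod.card]
    refine (max_le ?_ ?_).trans_lt hlt
    · refine natDegree_sum_le_of_forall_le _ _ fun u _ => deg _ ?_
      rw [natDegree_comp, natDegree_X_add_C, mul_one, hn]
    · refine natDegree_sum_le_of_forall_le _ _ fun u _ => deg _ ?_
      rw [natDegree_add_C, hn]
end

section
/- Let p be an odd prime and let U be a non-empty subset of F_p \ {0} such that ∑_{u ∈ U} u^k = 0 in F_p for all k = 1, 2, …, (p − 1)/2. Then |U| ≥ (p + 1)/2. -/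
/-- If the power sums of exponents `1, …, #U` over a finite set `U` of nonzero elements of a
domain vanish, then `#U` is zero in that domain. -/
theorem Finset.card_cast_eq_zero_of_sum_pow_eq_zero {R : Type*} [CommRing R] [IsDomain R]
    (U : Finset R) (hU0 : ∀ u ∈ U, u ≠ 0)
    (hS : ∀ k : ℕ, 1 ≤ k → k ≤ U.card → ∑ u ∈ U, u ^ k = 0) : (U.card : R) = 0 := by
  set f : Polynomial R := ∏ u ∈ U, (Polynomial.X - Polynomial.C u) with hf
  have hdeg : f.natDegree = U.card := by simp [hf]
  have h0 : f.coeff 0 ≠ 0 := by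
    rw [Polynomial.coeff_zero_eq_eval_zero, hf, Polynomial.eval_prod, Finset.prod_ne_zero_iff]
    intro u hu
    simpa using hU0 u hu
  have hsum : ∑ u ∈ U, f.eval u = 0 := Finset.sum_eq_zero fun u hu => by
    rw [hf, Polynomial.eval_prod]
    exact Finset.prod_eq_zero hu (by simp)
  simp_rw [Polynomial.eval_eq_sum_range] at hsum
  rw [Finset.sum_comm, Finset.sum_range_succ', Finset.sum_eq_zero, zero_add] at hsum
  · simpa [h0] using hsum
  · intro k hk
    rw [← Finset.mul_sum, hS (k + 1) (by omega) (by have := Finset.mem_range.mp hk; omega),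
      mul_zero]

/-- If the first `(p - 1)/2` power sums of a non-empty subset `U` of
`F_p \ {0}` vanish, then `|U| ≥ (p + 1)/2`. -/
theorem card_ge_of_power_sums_vanish (p : ℕ) (hp : p.Prime) (hodd : Odd p)
    (U : Finset (ZMod p)) (hUne : U.Nonempty) (hU0 : ∀ u ∈ U, u ≠ 0)
    (hS : ∀ k : ℕ, 1 ≤ k → k ≤ (p - 1) / 2 → ∑ u ∈ U, u ^ k = 0) :
    (p + 1) / 2 ≤ U.card := by
  have := Fact.mk hp
  by_contra! hlt
  have hpos := hUne.card_pos
  have hcast := U.card_cast_eq_zero_of_sum_pow_eq_zero hU0 fun k hk hkU =>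
    hS k hk (by obtain ⟨m, rfl⟩ := hodd; omega)
  have hle := Nat.le_of_dvd hpos ((ZMod.natCast_eq_zero_iff _ _).mp hcast)
  omega
end
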